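/- (Narrow Lemma) Let H ≤ G and let ψ be a 𝕂G-irrep with ψ ≅ ind_H^G(φ) for a 𝕂H-irrep φ. Then the following conditions are equivalent: (a) no Galois conjugate of φ distinct from φ occurs as a constituent of res_H^G(ψ); (b) the condition ψ' ≅ ind_H^G(φ') describes a bijective correspondence between the isomorphism classes of Galois conjugates ψ' of ψ and the isomorphism classes of Galois conjugates φ' of φ; (c) ℚ[φ] = ℚ[ψ]. -/

import Mathlib

open scoped Classical

noncomputable section

namespace Genotype

variable {k : Type} [Field k] {G : Type} [Group G]

/-- The subfield generated (over the prime field `ℚ`) by the values of a function,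
e.g. the field `ℚ[ψ]` generated by the values of a character. -/
def charField {X : Type} {k : Type} [Field k] (f : X → k) : Subfield k :=
  Subfield.closure (Set.range f)

theorem mem_charField {X : Type} {k : Type} [Field k] (f : X → k) (x : X) :
    f x ∈ charField f :=
  Subfield.subset_closure ⟨x, rfl⟩

/-- Two functions (typically characters of irreps over possibly different
characteristic-zero fields) are Galois conjugate: there is a Galois extension `M` of `ℚ`
containing (copies of) all their values and a field automorphism `α` of `M` with
`α (f g) = f' g` for all `g`. -/
def IsGaloisConj {k l : Type} [Field k] [Field l] {G : Type}
    (f : G → k) (f' : G → l) : Prop :=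
  ∃ (M : Type) (_ : Field M) (_ : Algebra ℚ M), IsGalois ℚ M ∧
    ∃ (i : charField f →+* M) (j : charField f' →+* M) (α : M ≃+* M),
      ∀ g : G, α (i ⟨f g, mem_charField f g⟩) = j ⟨f' g, mem_charField f' g⟩

/-- Irreducibility of a finite-dimensional representation. -/
def IsIrr (V : FDRep k G) : Prop :=
  Nontrivial V ∧
    ∀ U : Submodule k V, (∀ g : G, ∀ x ∈ U, V.ρ g x ∈ U) → U = ⊥ ∨ U = ⊤

/-- Faithfulness of a representation. -/
def IsFaithfulRep (V : FDRep k G) : Prop := Function.Injective V.ρ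

/-- `f` (the character of an irrep) occurs in the character `c`,
i.e. `c = f + (character of some representation)`. -/
def CharOccurs (f c : G → k) : Prop :=
  ∃ W : FDRep k G, c = f + W.character

/-- `f` (the character of an irrep) occurs in `c` with multiplicity exactly `m`. -/
def CharMult (f c : G → k) (m : ℕ) : Prop :=
  ∃ W : FDRep k G, c = m • f + W.character ∧ ¬ CharOccurs f W.character

/-- `f` is the character of an irreducible representation. -/
def IsIrrChar (f : G → k) : Prop := ∃ V : FDRep k G, IsIrr V ∧ f = V.character

/-- Restriction of a character to a subgroup. -/
def resChar (H : Subgroup G) (c : G → k) : H → k := fun h => c h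

/-- The induced character `ind_H^G f`. -/
def indChar (H : Subgroup G) (f : H → k) : G → k := fun g =>
  (Nat.card H : k)⁻¹ *
    ∑ᶠ x : G, if h : x⁻¹ * g * x ∈ H then f ⟨x⁻¹ * g * x, h⟩ else 0

/-- The character `cψ` (of a `kG`-irrep) is tightly induced from the character `cφ`
(of a `kH`-irrep): `cψ` is the induced character of `cφ`, `cφ` occurs with multiplicity
exactly `1` in the restriction of `cψ`, and no Galois conjugate of `cφ` other than `cφ`
itself occurs in the restriction of `cψ`. -/
def TightInd (H : Subgroup G) (cψ : G → k) (cφ : H → k) : Prop :=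
  cψ = indChar H cφ ∧ CharMult cφ (resChar H cψ) 1 ∧
    ∀ cφ' : H → k, IsIrrChar cφ' → IsGaloisConj cφ cφ' →
      CharOccurs cφ' (resChar H cψ) → cφ' = cφ

/-- Tight induction from a subquotient `H/K` of `G`: tight induction from `H`
of the inflation. -/
def TightIndSub (H : Subgroup G) (K : Subgroup H) [K.Normal]
    (cψ : G → k) (cφ : (H ⧸ K) → k) : Prop :=
  TightInd H cψ (fun h => cφ (QuotientGroup.mk h))

/-- A group is Roquette if every normal abelian subgroup of it is cyclic. -/
def IsRoquette (P : Type) [Group P] : Prop :=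
  ∀ A : Subgroup P, A.Normal → (∀ x ∈ A, ∀ y ∈ A, x * y = y * x) → IsCyclic A

/-- `χ` is the rational form `ψ_ℚ` of `V`: a rational irrep such that `V` occurs in the
scalar extension `k ⊗_ℚ χ`. -/
def IsRatForm [CharZero k] (χ : FDRep ℚ G) (V : FDRep k G) : Prop :=
  IsIrr χ ∧ CharOccurs V.character (fun g => algebraMap ℚ k (χ.character g))

/-- Irreps over possibly different characteristic-zero fields are quasiconjugate if they
determine the same rational irrep. -/
def Quasiconj {k l : Type} [Field k] [Field l] [CharZero k] [CharZero l] {G : Type} [Group G]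
    (V : FDRep k G) (W : FDRep l G) : Prop :=
  ∃ χ : FDRep ℚ G, IsRatForm χ V ∧ IsRatForm χ W

end Genotype

namespace Genotype

set_option linter.unusedSectionVars false
set_option linter.style.haveILetI false
section CT

variable {k : Type} [Field k] [CharZero k] {G : Type} [Group G] [Fintype G]

/-- scalar product of class functions -/
def ip (f f' : G → k) : k := (Nat.card G : k)⁻¹ * ∑ g : G, f g * f' g⁻¹

theorem ip_add_left (f f' h : G → k) : ip (f + f') h = ip f h + ip f' h := by
  simp [ip, add_mul, Finset.sum_add_distrib, mul_add]

theorem ip_sub_left (f f' h : G → k) : ip (f - f') h = ip f h - ip f' h := by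
  simp [ip, sub_mul, Finset.sum_sub_distrib, mul_sub]

theorem ip_smul_left (c : k) (f h : G → k) : ip (c • f) h = c * ip f h := by
  simp only [ip, Pi.smul_apply, smul_eq_mul, Finset.mul_sum]
  refine Finset.sum_congr rfl fun g _ => by ring

theorem ip_comm (f h : G → k) : ip f h = ip h f := by
  unfold ip
  congr 1
  rw [← Equiv.sum_comp (Equiv.inv G)]
  simp [mul_comm]

theorem ip_zero_left (f : G → k) : ip (0 : G → k) f = 0 := by simp [ip]

theorem ip_char (V W : FDRep k G) :
    ip W.character V.character = Module.finrank k (Representation.IntertwiningMap V.ρ W.ρ) := by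
  haveI : Invertible (Nat.card G : k) := invertibleOfNonzero (by simp)
  exact Representation.card_inv_mul_sum_char_mul_char_eq_finrank V.ρ W.ρ

theorem schur {V W : FDRep k G} (hV : IsIrr V) (hW : IsIrr W)
    (h : ip W.character V.character ≠ 0) : W.character = V.character := by
  rw [ip_char] at h
  have h0 : Module.finrank k (Representation.IntertwiningMap V.ρ W.ρ) ≠ 0 := by
    intro h'; rw [h'] at h; simp at h
  have : Nontrivial (Representation.IntertwiningMap V.ρ W.ρ) :=
    Module.nontrivial_of_finrank_pos (R := k) (Nat.pos_of_ne_zero h0)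
  obtain ⟨f, hf⟩ := exists_ne (0 : Representation.IntertwiningMap V.ρ W.ρ)
  have hcomm : ∀ g x, f (V.ρ g x) = W.ρ g (f x) := Representation.IntertwiningMap.isIntertwining _ _ f
  have hker : LinearMap.ker f.toLinearMap = ⊥ := by
    rcases hV.2 (LinearMap.ker f.toLinearMap) (fun g x hx => by
      have hx' : f x = 0 := hx
      show f (V.ρ g x) = 0
      rw [hcomm, hx', map_zero]) with h1 | h1
    · exact h1
    · exfalso
      apply hf
      ext x
      have : x ∈ LinearMap.ker f.toLinearMap := by rw [h1]; trivial
      exact this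
  have hran : LinearMap.range f.toLinearMap = ⊤ := by
    rcases hW.2 (LinearMap.range f.toLinearMap) (fun g x hx => by
      obtain ⟨y, rfl⟩ := hx
      exact ⟨V.ρ g y, hcomm g y⟩) with h1 | h1
    · exfalso
      apply hf
      ext x
      have : f x ∈ LinearMap.range f.toLinearMap := ⟨x, rfl⟩
      rw [h1] at this
      exact this
    · exact h1
  let e : V ≃ₗ[k] W := LinearEquiv.ofBijective f.toLinearMap
    ⟨LinearMap.ker_eq_bot.1 hker, LinearMap.range_eq_top.1 hran⟩
  ext g
  unfold FDRep.character
  have : W.ρ g = e.conj (V.ρ g) := by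
    ext y
    obtain ⟨x, rfl⟩ := e.surjective y
    simp only [LinearEquiv.conj_apply_apply, LinearEquiv.symm_apply_apply]
    exact (hcomm g x).symm
  rw [this, LinearMap.trace_conj']

theorem ip_self_pos {V : FDRep k G} (hV : IsIrr V) :
    ∃ d : ℕ, 0 < d ∧ ip V.character V.character = d := by
  refine ⟨_, ?_, ip_char V V⟩
  have := hV.1
  rw [Module.finrank_pos_iff]
  obtain ⟨x, hx⟩ := exists_ne (0 : V)
  refine ⟨Representation.IntertwiningMap.id V.ρ, 0, fun h => hx ?_⟩
  have := congrArg (fun f : Representation.IntertwiningMap V.ρ V.ρ => f x) h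
  simpa using this

theorem exists_add (V W : FDRep k G) :
    ∃ U : FDRep k G, U.character = V.character + W.character := by
  refine ⟨FDRep.of (Representation.prod V.ρ W.ρ), ?_⟩
  ext g
  exact LinearMap.trace_prodMap' (V.ρ g) (W.ρ g)

theorem exists_zero : ∃ U : FDRep k G, U.character = 0 := by
  refine ⟨FDRep.of (1 : Representation k G PUnit), ?_⟩
  ext g
  simp [FDRep.character, Subsingleton.elim _ (0 : PUnit →ₗ[k] PUnit)]

theorem exists_compl (V : FDRep k G) (U : Submodule k V) (hU : ∀ g : G, ∀ x ∈ U, V.ρ g x ∈ U) :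
    ∃ U' : Submodule k V, (∀ g : G, ∀ x ∈ U', V.ρ g x ∈ U') ∧ IsCompl U U' := by
  haveI : NeZero (Nat.card G : k) := ⟨by simp⟩
  let S : Subrepresentation V.ρ := ⟨U, fun g x hx => hU g x hx⟩
  obtain ⟨q, hq⟩ := MonoidAlgebra.Submodule.exists_isCompl (Subrepresentation.asSubmodule S)
  let e := Subrepresentation.subrepresentationSubmoduleOrderIso (ρ := V.ρ)
  refine ⟨(e.symm q).toSubmodule, fun g x hx => (e.symm q).apply_mem_toSubmodule g hx, ?_⟩
  constructor
  · rw [Submodule.disjoint_def]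
    intro x hx hx'
    exact Submodule.disjoint_def.1 hq.disjoint x hx hx'
  · rw [codisjoint_iff, eq_top_iff]
    rintro x -
    have hx : (show Representation.asModule V.ρ from x) ∈ (Subrepresentation.asSubmodule S) ⊔ q := by
      rw [hq.sup_eq_top]; trivial
    obtain ⟨y, hy, z, hz, hyz⟩ := Submodule.mem_sup.1 hx
    exact Submodule.mem_sup.2 ⟨y, hy, z, hz, hyz⟩

theorem char_compl (V : FDRep k G) (U U' : Submodule k V) (hU : ∀ g : G, ∀ x ∈ U, V.ρ g x ∈ U)
    (hU' : ∀ g : G, ∀ x ∈ U', V.ρ g x ∈ U') (h : IsCompl U U') :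
    ∃ A B : FDRep k G, Module.finrank k A = Module.finrank k U ∧
      Module.finrank k B = Module.finrank k U' ∧ V.character = A.character + B.character := by
  let S : Subrepresentation V.ρ := ⟨U, fun g x hx => hU g x hx⟩
  let S' : Subrepresentation V.ρ := ⟨U', fun g x hx => hU' g x hx⟩
  refine ⟨FDRep.of S.toRepresentation, FDRep.of S'.toRepresentation, rfl, rfl, ?_⟩
  ext g
  let N : Bool → Submodule k V := fun b => if b then U else U'
  have hN : DirectSum.IsInternal N := by
    rw [DirectSum.isInternal_submodule_iff_isCompl N (i := true) (j := false) (by decide)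
      (by ext b; cases b <;> simp)]
    exact h
  have hf : ∀ b, Set.MapsTo (V.ρ g) (N b) (N b) := by
    rintro (_ | _)
    · exact fun x hx => hU' g x hx
    · exact fun x hx => hU g x hx
  have := LinearMap.trace_eq_sum_trace_restrict hN hf
  rw [Fintype.sum_bool] at this
  exact this

theorem char_induction (P : (G → k) → Prop) (h0 : P 0) (hi : ∀ V : FDRep k G, IsIrr V → P V.character)
    (ha : ∀ V W : FDRep k G, P V.character → P W.character → P (V.character + W.character))
    (V : FDRep k G) : P V.character := by
  induction hn : Module.finrank k V using Nat.strong_induction_on generalizing V with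
  | _ n ih =>
    by_cases hV : IsIrr V
    · exact hi V hV
    by_cases hnt : Nontrivial V
    · have : ∃ U : Submodule k V, (∀ g : G, ∀ x ∈ U, V.ρ g x ∈ U) ∧ U ≠ ⊥ ∧ U ≠ ⊤ := by
        by_contra hcon
        push Not at hcon
        refine hV ⟨hnt, fun U hU => ?_⟩
        by_cases h : U = ⊥
        · exact Or.inl h
        · exact Or.inr (hcon U hU h)
      obtain ⟨U, hU, hb, ht⟩ := this
      obtain ⟨U', hU', hc⟩ := exists_compl V U hU
      obtain ⟨A, B, hA, hB, hAB⟩ := char_compl V U U' hU hU' hc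
      have h1 := Submodule.finrank_lt ht
      have h2 := Submodule.finrank_add_eq_of_isCompl hc
      have h3 : Module.finrank k U ≠ 0 := by
        rw [Ne, Submodule.finrank_eq_zero]; exact hb
      rw [hAB]
      exact ha A B (ih _ (by omega) A rfl) (ih _ (by omega) B rfl)
    · rw [not_nontrivial_iff_subsingleton] at hnt
      have : V.character = 0 := by
        ext g
        have : V.ρ g = 0 := Subsingleton.elim _ _
        simp [FDRep.character, this]
      rw [this]; exact h0

theorem ip_irr_dvd {T : FDRep k G} (hT : IsIrr T) (W : FDRep k G) :
    ∃ m : ℕ, ip W.character T.character = m * ip T.character T.character := by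
  refine char_induction (fun f => ∃ m : ℕ, ip f T.character = m * ip T.character T.character)
    ⟨0, by simp [ip_zero_left]⟩ ?_ ?_ W
  · intro V hV
    by_cases h : ip V.character T.character = 0
    · exact ⟨0, by simp [h]⟩
    · exact ⟨1, by simp [schur hT hV h]⟩
  · rintro V W ⟨a, ha⟩ ⟨b, hb⟩
    exact ⟨a + b, by rw [ip_add_left, ha, hb]; push_cast; ring⟩

theorem occurs_iff {T : FDRep k G} (hT : IsIrr T) (W : FDRep k G) :
    CharOccurs T.character W.character ↔ ip W.character T.character ≠ 0 := by
  constructor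
  · rintro ⟨U, hU⟩
    obtain ⟨m, hm⟩ := ip_irr_dvd hT U
    obtain ⟨d, hd, hd'⟩ := ip_self_pos hT
    rw [hU, ip_add_left, hm, hd']
    have : ((d + m * d : ℕ) : k) ≠ 0 := by rw [Nat.cast_ne_zero]; positivity
    exact_mod_cast this
  · refine char_induction (fun f => ip f T.character ≠ 0 → CharOccurs T.character f) ?_ ?_ ?_ W
    · intro h; exact absurd (ip_zero_left _) h
    · intro V hV h
      obtain ⟨Z, hZ⟩ := exists_zero (k := k) (G := G)
      exact ⟨Z, by rw [hZ, schur hT hV h, add_zero]⟩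
    · intro V W hV hW h
      rw [ip_add_left] at h
      by_cases h1 : ip V.character T.character = 0
      · have h2 : ip W.character T.character ≠ 0 := by
          intro h2; apply h; rw [h1, h2, add_zero]
        obtain ⟨U, hU⟩ := hW h2
        obtain ⟨Z, hZ⟩ := exists_add V U
        exact ⟨Z, by rw [hZ, hU]; abel⟩
      · obtain ⟨U, hU⟩ := hV h1
        obtain ⟨Z, hZ⟩ := exists_add U W
        exact ⟨Z, by rw [hZ, hU]; abel⟩

/-- virtual characters -/
def IsVirt (f : G → k) : Prop := ∃ A B : FDRep k G, f = A.character - B.character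

theorem virt_ip {f : G → k} (hf : IsVirt f) {T : FDRep k G} (hT : IsIrr T) :
    ∃ m : ℤ, ip f T.character = m * ip T.character T.character := by
  obtain ⟨A, B, rfl⟩ := hf
  obtain ⟨a, ha⟩ := ip_irr_dvd hT A
  obtain ⟨b, hb⟩ := ip_irr_dvd hT B
  exact ⟨a - b, by rw [ip_sub_left, ha, hb]; push_cast; ring⟩

theorem exists_irr_of_virt {f : G → k} (hf : IsVirt f) (h : ip f f ≠ 0) :
    ∃ T : FDRep k G, IsIrr T ∧ ip f T.character ≠ 0 := by
  by_contra hcon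
  push Not at hcon
  have key : ∀ W : FDRep k G, ip f W.character = 0 := by
    refine char_induction (fun c => ip f c = 0) ?_ hcon ?_
    · rw [ip_comm, ip_zero_left]
    · intro V W hV hW
      rw [ip_comm, ip_add_left, ip_comm _ f, ip_comm _ f, hV, hW, add_zero]
  apply h
  obtain ⟨A, B, hAB⟩ := hf
  nth_rw 2 [hAB]
  rw [ip_comm, ip_sub_left, ip_comm _ f, ip_comm _ f, key, key, sub_zero]

end CT
end Genotype
namespace Genotype
set_option linter.style.haveILetI false
section EV

theorem trace_pow_of_pow_eq_one {K V : Type*} [Field K] [CharZero K] [IsAlgClosed K]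
    [AddCommGroup V] [Module K V] [FiniteDimensional K V] {n : ℕ} (hn : 0 < n)
    {ζ : K} (hζ : IsPrimitiveRoot ζ n) (f : Module.End K V) (hf : f ^ n = 1) :
    ∃ d : Fin n → ℕ, ∀ m : ℕ, LinearMap.trace K V (f ^ m) = ∑ e : Fin n, d e * (ζ ^ (e : ℕ)) ^ m := by
  have hss : f.IsSemisimple := by
    refine Module.End.isSemisimple_of_squarefree_aeval_eq_zero
      (p := Polynomial.X ^ n - Polynomial.C (1:K)) ?_ (by simp [hf])
    exact (Polynomial.separable_X_pow_sub_C (1 : K) (by exact_mod_cast hn.ne') one_ne_zero).squarefree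
  let N : Fin n → Submodule K V := fun e => f.eigenspace (ζ ^ (e : ℕ))
  have hinj : Function.Injective (fun e : Fin n => ζ ^ (e : ℕ)) := fun a b h =>
    Fin.ext (hζ.pow_inj a.2 b.2 h)
  have hint : DirectSum.IsInternal N := by
    rw [DirectSum.isInternal_submodule_iff_iSupIndep_and_iSup_eq_top]
    refine ⟨f.eigenspaces_iSupIndep.comp hinj, ?_⟩
    rw [eq_top_iff, ← hss.iSup_eigenspace_eq_top, iSup_le_iff]
    intro μ x hx
    by_cases hx0 : x = 0
    · rw [hx0]; exact zero_mem _
    · have hxm : f x = μ • x := Module.End.mem_eigenspace_iff.1 hx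
      have hpow : ∀ m : ℕ, (f ^ m) x = μ ^ m • x := by
        intro m
        induction m with
        | zero => simp
        | succ m ih => rw [pow_succ, Module.End.mul_apply, hxm, map_smul, ih, smul_smul, pow_succ']
      have h1 : μ ^ n = 1 := by
        have := hpow n
        rw [hf, Module.End.one_apply] at this
        have h2 : (μ ^ n - 1) • x = 0 := by rw [sub_smul, ← this]; simp
        rcases smul_eq_zero.1 h2 with h3 | h3
        · exact sub_eq_zero.1 h3
        · exact absurd h3 hx0
      haveI : NeZero n := ⟨hn.ne'⟩
      obtain ⟨i, hi, rfl⟩ := hζ.eq_pow_of_pow_eq_one h1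
      exact Submodule.mem_iSup_of_mem (⟨i, hi⟩ : Fin n) hx
  refine ⟨fun e => Module.finrank K (N e), fun m => ?_⟩
  have hpow : ∀ (e : Fin n) (x : V), x ∈ N e → (f ^ m) x = (ζ ^ (e : ℕ)) ^ m • x := by
    intro e x hx
    have hxm : f x = ζ ^ (e : ℕ) • x := Module.End.mem_eigenspace_iff.1 hx
    induction m with
    | zero => simp
    | succ m ih => rw [pow_succ, Module.End.mul_apply, hxm, map_smul, ih, smul_smul, pow_succ' _ m]
  have hmaps : ∀ e, Set.MapsTo (f ^ m) (N e) (N e) := by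
    intro e x hx
    rw [hpow e x hx]
    exact Submodule.smul_mem _ _ hx
  rw [LinearMap.trace_eq_sum_trace_restrict hint hmaps]
  refine Finset.sum_congr rfl fun e _ => ?_
  have : (f ^ m).restrict (hmaps e) = (ζ ^ (e : ℕ)) ^ m • LinearMap.id := by
    ext x
    exact hpow e x x.2
  rw [this, map_smul, LinearMap.trace_id, smul_eq_mul, mul_comm]

theorem char_pow {k : Type} [Field k] [CharZero k] {K : Type} [Field K] [Algebra k K]
    [IsAlgClosed K] {G : Type} [Group G] {n : ℕ} (hn : 0 < n) {ζ : K} (hζ : IsPrimitiveRoot ζ n)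
    (V : FDRep k G) (g : G) (hg : g ^ n = 1) :
    ∃ d : Fin n → ℕ, ∀ m : ℕ, algebraMap k K (V.character (g ^ m)) =
      ∑ e : Fin n, d e * (ζ ^ (e : ℕ)) ^ m := by
  haveI : CharZero K := charZero_of_injective_algebraMap (algebraMap k K).injective
  have hb : ∀ m : ℕ, (V.ρ (g ^ m)).baseChange K = ((V.ρ g).baseChange K) ^ m := by
    intro m
    rw [map_pow]
    induction m with
    | zero => simp [Module.End.one_eq_id]
    | succ m ih => rw [pow_succ, pow_succ, ← ih, Module.End.mul_eq_comp, LinearMap.baseChange_comp]; rfl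
  obtain ⟨d, hd⟩ := trace_pow_of_pow_eq_one hn hζ ((V.ρ g).baseChange K) (by
    rw [← hb, hg, map_one, Module.End.one_eq_id, LinearMap.baseChange_id]; rfl)
  refine ⟨d, fun m => ?_⟩
  rw [← hd, ← hb, LinearMap.trace_baseChange]
  rfl


variable (k : Type) [Field k] [CharZero k]

instance instCZ : CharZero (AlgebraicClosure k) :=
  charZero_of_injective_algebraMap (algebraMap k _).injective

/-- algebraic numbers in the algebraic closure of `k` -/
abbrev MM : IntermediateField ℚ (AlgebraicClosure k) := algebraicClosure ℚ (AlgebraicClosure k)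

instance instACl : IsAlgClosure ℚ (MM k) := by
  have := algebraicClosure.isAlgClosure ℚ (AlgebraicClosure k)
  convert this
  · rfl
  · exact Subsingleton.elim (α := Algebra ℚ (MM k)) _ _

instance instAC : IsAlgClosed (MM k) := IsAlgClosure.isAlgClosed ℚ

instance instAlg : Algebra.IsAlgebraic ℚ (MM k) := IsAlgClosure.isAlgebraic

instance instGal : IsGalois ℚ (MM k) where
  to_normal := IsAlgClosure.normal ℚ (MM k)

theorem exists_zeta {n : ℕ} (hn : 0 < n) : ∃ ζ : MM k, IsPrimitiveRoot ζ n := by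
  haveI : NeZero n := ⟨hn.ne'⟩
  haveI : NeZero (n : MM k) := ⟨by exact_mod_cast hn.ne'⟩
  exact HasEnoughRootsOfUnity.exists_primitiveRoot (MM k) n

theorem exists_sigma {n : ℕ} {ζ : MM k} (hn : 0 < n) (hζ : IsPrimitiveRoot ζ n) {a : ℕ}
    (ha : a.Coprime n) : ∃ σ : MM k ≃ₐ[ℚ] MM k, σ ζ = ζ ^ a := by
  have hm : minpoly ℚ ζ = minpoly ℚ (ζ ^ a) := by
    have h1 := Polynomial.cyclotomic_eq_minpoly_rat hζ hn
    have h2 := Polynomial.cyclotomic_eq_minpoly_rat (hζ.pow_of_coprime a ha) hn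
    rw [← h1, ← h2]
  refine minpoly.exists_algEquiv_of_root' (Algebra.IsAlgebraic.isAlgebraic ζ) ?_
  rw [hm]
  exact minpoly.aeval _ _

variable {k} {G : Type} [Group G]

theorem char_mm {n : ℕ} (hn : 0 < n) {ζ : MM k} (hζ : IsPrimitiveRoot ζ n)
    (V : FDRep k G) (g : G) (hg : g ^ n = 1) :
    ∃ d : Fin n → ℕ, ∀ m : ℕ, algebraMap k (AlgebraicClosure k) (V.character (g ^ m)) =
      ((∑ e : Fin n, d e * (ζ ^ (e : ℕ)) ^ m : MM k) : AlgebraicClosure k) := by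
  have hζ' : IsPrimitiveRoot (ζ : AlgebraicClosure k) n := by
    exact hζ.map_of_injective (f := (MM k).val) (MM k).val.injective
  obtain ⟨d, hd⟩ := char_pow hn hζ' V g hg
  exact ⟨d, fun m => by rw [hd]; push_cast; rfl⟩

theorem charField_le {n : ℕ} (hn : 0 < n) (hG : ∀ g : G, g ^ n = 1) (V : FDRep k G) :
    charField V.character ≤ (MM k).toSubfield.comap (algebraMap k (AlgebraicClosure k)) := by
  refine Subfield.closure_le.2 ?_
  rintro _ ⟨g, rfl⟩
  obtain ⟨ζ, hζ⟩ := exists_zeta k hn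
  obtain ⟨d, hd⟩ := char_mm hn hζ V g (hG g)
  have := hd 1
  rw [pow_one] at this
  show algebraMap k (AlgebraicClosure k) (V.character g) ∈ MM k
  rw [this]
  exact Subtype.property _

/-- embedding of the character field -/
def emb {n : ℕ} (hn : 0 < n) (hG : ∀ g : G, g ^ n = 1) (V : FDRep k G) :
    charField V.character →+* MM k :=
  RingHom.codRestrict ((algebraMap k (AlgebraicClosure k)).comp (charField V.character).subtype)
    (MM k) (fun x => charField_le hn hG V x.2)

theorem emb_coe {n : ℕ} (hn : 0 < n) (hG : ∀ g : G, g ^ n = 1) (V : FDRep k G)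
    (x : charField V.character) :
    ((emb hn hG V x : MM k) : AlgebraicClosure k) = algebraMap k (AlgebraicClosure k) x := rfl

theorem emb_char {n : ℕ} (hn : 0 < n) (hG : ∀ g : G, g ^ n = 1) {ζ : MM k}
    (hζ : IsPrimitiveRoot ζ n) (V : FDRep k G) (g : G) :
    ∃ d : Fin n → ℕ, ∀ m : ℕ, emb hn hG V ⟨V.character (g ^ m), mem_charField _ _⟩ =
      ∑ e : Fin n, d e * (ζ ^ (e : ℕ)) ^ m := by
  obtain ⟨d, hd⟩ := char_mm hn hζ V g (hG g)
  exact ⟨d, fun m => Subtype.ext (hd m)⟩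

/-- a hom which raises roots of unity to the power `a` acts on characters by `g ↦ g^a`. -/
theorem hom_char {n : ℕ} (hn : 0 < n) (hG : ∀ g : G, g ^ n = 1) {ζ : MM k}
    (hζ : IsPrimitiveRoot ζ n) {L : Type} [Field L] (I J : MM k →+* L) {a : ℕ}
    (hIJ : I ζ = (J ζ) ^ a) (V : FDRep k G) (g : G) :
    I (emb hn hG V ⟨V.character g, mem_charField _ _⟩) =
      J (emb hn hG V ⟨V.character (g ^ a), mem_charField _ _⟩) := by
  obtain ⟨d, hd⟩ := emb_char hn hG hζ V g
  have h1 := hd 1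
  simp only [pow_one] at h1
  rw [h1, hd a, map_sum, map_sum]
  refine Finset.sum_congr rfl fun e _ => ?_
  simp only [map_mul, map_natCast, map_pow, hIJ]
  rw [pow_right_comm]

theorem extend_hom {F : Type} [Field F] [CharZero F] (ε : F →+* MM k) {L : Type} [Field L]
    [IsAlgClosed L] (A : F →+* L) : ∃ I : MM k →+* L, ∀ x, I (ε x) = A x := by
  letI := ε.toAlgebra
  letI := A.toAlgebra
  haveI : Algebra.IsAlgebraic F (MM k) := Algebra.IsAlgebraic.tower_top (K := ℚ) F
  refine ⟨(IsAlgClosed.lift (R := F) (S := MM k) (M := L) : MM k →ₐ[F] L).toRingHom, fun x => ?_⟩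
  exact (IsAlgClosed.lift (R := F) (S := MM k) (M := L) : MM k →ₐ[F] L).commutes x

theorem galConj_pow {n : ℕ} (hn : 0 < n) (hG : ∀ g : G, g ^ n = 1) (V W : FDRep k G)
    (h : IsGaloisConj V.character W.character) :
    ∃ a : ℕ, a.Coprime n ∧ ∀ g, W.character g = V.character (g ^ a) := by
  obtain ⟨M, _, _, _, i, j, α, hα⟩ := h
  obtain ⟨ζ, hζ⟩ := exists_zeta k hn
  let L := AlgebraicClosure M
  obtain ⟨I, hI⟩ := extend_hom (emb hn hG V) ((algebraMap M L).comp (α.toRingHom.comp i))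
  obtain ⟨J, hJ⟩ := extend_hom (emb hn hG W) ((algebraMap M L).comp j)
  have hIp : IsPrimitiveRoot (I ζ) n := hζ.map_of_injective I.injective
  have hJp : IsPrimitiveRoot (J ζ) n := hζ.map_of_injective J.injective
  haveI : NeZero n := ⟨hn.ne'⟩
  obtain ⟨a, -, ha⟩ := hJp.eq_pow_of_pow_eq_one hIp.pow_eq_one
  have hcop : a.Coprime n := by
    rw [← hJp.pow_iff_coprime hn, ha]; exact hIp
  refine ⟨a, hcop, fun g => ?_⟩
  have h1 := hom_char hn hG hζ I J ha.symm V g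
  have h2 : J (emb hn hG W ⟨W.character g, mem_charField _ _⟩) =
      J (emb hn hG V ⟨V.character (g ^ a), mem_charField _ _⟩) := by
    rw [← h1, hI, hJ]
    simp only [RingHom.comp_apply]
    rw [← hα g]
    rfl
  have h3 := congrArg (fun x : MM k => (x : AlgebraicClosure k)) (J.injective h2)
  exact (algebraMap k (AlgebraicClosure k)).injective h3

theorem galConj_of_pow {n : ℕ} (hn : 0 < n) (hG : ∀ g : G, g ^ n = 1) (V W : FDRep k G)
    {a : ℕ} (ha : a.Coprime n) (h : ∀ g, W.character g = V.character (g ^ a)) :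
    IsGaloisConj V.character W.character := by
  obtain ⟨ζ, hζ⟩ := exists_zeta k hn
  obtain ⟨σ, hσ⟩ := exists_sigma k hn hζ ha
  refine ⟨MM k, inferInstance, inferInstance, inferInstance, emb hn hG V, emb hn hG W,
    σ.toRingEquiv, fun g => ?_⟩
  refine (hom_char hn hG hζ (σ.toRingEquiv.toRingHom) (RingHom.id _) hσ V g).trans ?_
  apply Subtype.ext
  simp only [RingHom.id_apply, emb_coe, h]

theorem pow_eq_of_field {G' : Type} [Group G'] {n : ℕ} (hn : 0 < n) (hG : ∀ g : G, g ^ n = 1)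
    (hG' : ∀ g : G', g ^ n = 1) (V : FDRep k G) (W : FDRep k G')
    (hle : charField W.character ≤ charField V.character) {a b : ℕ} (ha : a.Coprime n)
    (hb : b.Coprime n) (h : ∀ g, V.character (g ^ a) = V.character (g ^ b)) (g : G') :
    W.character (g ^ a) = W.character (g ^ b) := by
  obtain ⟨ζ, hζ⟩ := exists_zeta k hn
  obtain ⟨σ, hσ⟩ := exists_sigma k hn hζ ha
  obtain ⟨τ, hτ⟩ := exists_sigma k hn hζ hb
  have key : ∀ x (hx : x ∈ charField V.character),
      σ (emb hn hG V ⟨x, hx⟩) = τ (emb hn hG V ⟨x, hx⟩) := by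
    intro x hx
    refine Subfield.closure_induction (p := fun x hx =>
      σ (emb hn hG V ⟨x, hx⟩) = τ (emb hn hG V ⟨x, hx⟩)) ?_ ?_ ?_ ?_ ?_ ?_ hx
    · rintro _ ⟨y, rfl⟩
      refine (hom_char hn hG hζ (σ.toRingEquiv.toRingHom) (RingHom.id _) hσ V y).trans
        (Eq.trans ?_ (hom_char hn hG hζ (τ.toRingEquiv.toRingHom) (RingHom.id _) hτ V y).symm)
      simp only [h]
    · have : (⟨1, one_mem _⟩ : charField V.character) = 1 := rfl
      rw [this]; simp
    · intro x y hx hy h1 h2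
      have : (⟨x + y, add_mem hx hy⟩ : charField V.character) = ⟨x, hx⟩ + ⟨y, hy⟩ := rfl
      erw [this]; simp only [map_add, h1, h2]
    · intro x hx h1
      have : (⟨-x, neg_mem hx⟩ : charField V.character) = -⟨x, hx⟩ := rfl
      erw [this]; simp only [map_neg, h1]
    · intro x hx h1
      have : (⟨x⁻¹, inv_mem hx⟩ : charField V.character) = ⟨x, hx⟩⁻¹ := rfl
      erw [this]; simp only [map_inv₀, h1]
    · intro x y hx hy h1 h2
      have : (⟨x * y, mul_mem hx hy⟩ : charField V.character) = ⟨x, hx⟩ * ⟨y, hy⟩ := rfl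
      erw [this]; simp only [map_mul, h1, h2]
  have h1 := hom_char hn hG' hζ (σ.toRingEquiv.toRingHom) (RingHom.id _) hσ W g
  have h2 := hom_char hn hG' hζ (τ.toRingEquiv.toRingHom) (RingHom.id _) hτ W g
  have h3 := key (W.character g) (hle (mem_charField _ _))
  have h4 := h1.symm.trans (Eq.trans h3 h2)
  exact (algebraMap k (AlgebraicClosure k)).injective (congrArg Subtype.val h4)

theorem field_le_of_pow {G' : Type} [Group G'] {n : ℕ} (hn : 0 < n) (hG : ∀ g : G, g ^ n = 1)
    (hG' : ∀ g : G', g ^ n = 1) (V : FDRep k G) (W : FDRep k G')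
    (h : ∀ a : ℕ, a.Coprime n → (∀ g, V.character (g ^ a) = V.character g) →
      ∀ g, W.character (g ^ a) = W.character g) :
    charField W.character ≤ charField V.character := by
  refine Subfield.closure_le.2 ?_
  rintro _ ⟨g, rfl⟩
  obtain ⟨ζ, hζ⟩ := exists_zeta k hn
  letI := (emb hn hG V).toAlgebra
  haveI : IsGalois (charField V.character) (MM k) :=
    IsGalois.tower_top_of_isGalois ℚ (charField V.character) (MM k)
  have hfix : ∀ σ : MM k ≃ₐ[charField V.character] MM k,
      σ (emb hn hG' W ⟨W.character g, mem_charField _ _⟩) =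
        emb hn hG' W ⟨W.character g, mem_charField _ _⟩ := by
    intro σ
    haveI : NeZero n := ⟨hn.ne'⟩
    have hσp : IsPrimitiveRoot (σ ζ) n := hζ.map_of_injective σ.injective
    obtain ⟨a, -, ha⟩ := hζ.eq_pow_of_pow_eq_one hσp.pow_eq_one
    have hcop : a.Coprime n := by
      rw [← hζ.pow_iff_coprime hn, ha]; exact hσp
    have h1 : ∀ g, V.character (g ^ a) = V.character g := by
      intro g
      have h2 := hom_char hn hG hζ (σ.toRingEquiv.toRingHom) (RingHom.id _) ha.symm V g
      have h3 : σ (emb hn hG V ⟨V.character g, mem_charField _ _⟩) = _ := σ.commutes _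
      have h4 := h2.symm.trans h3
      exact (algebraMap k (AlgebraicClosure k)).injective (congrArg Subtype.val h4)
    have h5 := hom_char hn hG' hζ (σ.toRingEquiv.toRingHom) (RingHom.id _) ha.symm W g
    refine h5.trans ?_
    simp only [h a hcop h1, RingHom.id_apply]
  obtain ⟨z, hz⟩ := (InfiniteGalois.mem_range_algebraMap_iff_fixed _).2 hfix
  have h6 : (z : k) = W.character g :=
    (algebraMap k (AlgebraicClosure k)).injective (congrArg Subtype.val hz)
  rw [← h6]
  exact z.2

end EV
end Genotype
namespace Genotype
set_option linter.style.haveILetI false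
section Adams

theorem pow_path {k ι : Type} [Field k] [Fintype ι] [DecidableEq ι] (A : Matrix ι ι k) (N : ℕ) (i j : ι) :
    (A ^ (N + 1)) i j = ∑ a : Fin N → ι, ∏ x : Fin (N + 1),
      A ((Fin.cons i a : Fin (N + 1) → ι) x) ((Fin.snoc a j : Fin (N + 1) → ι) x) := by
  induction N generalizing i with
  | zero => simp [Fin.snoc]
  | succ N ih =>
    rw [pow_succ', Matrix.mul_apply]
    simp_rw [ih, Finset.mul_sum]
    rw [← (Fin.consEquiv (fun _ : Fin (N + 1) => ι)).sum_comp, Fintype.sum_prod_type]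
    refine Finset.sum_congr rfl fun l _ => Finset.sum_congr rfl fun a _ => ?_
    conv_rhs => rw [Fin.prod_univ_succ]
    congr 1
    refine Finset.prod_congr rfl fun y _ => ?_
    simp only [Fin.consEquiv, Equiv.coe_fn_mk, Fin.cons_succ]
    rw [← Fin.cons_snoc_eq_snoc_cons, Fin.cons_succ]

theorem trace_cycle {k ι : Type} [Field k] [Fintype ι] [DecidableEq ι] (A : Matrix ι ι k) (N : ℕ) :
    Matrix.trace (A ^ (N + 1)) = ∑ a : Fin (N + 1) → ι, ∏ x : Fin (N + 1), A (a x) (a (x + 1)) := by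
  rw [Matrix.trace]
  simp_rw [Matrix.diag, pow_path]
  rw [← (Fin.consEquiv (fun _ : Fin (N + 1) => ι)).sum_comp, Fintype.sum_prod_type]
  refine Finset.sum_congr rfl fun l _ => Finset.sum_congr rfl fun a _ =>
    Finset.prod_congr rfl fun x _ => ?_
  simp only [Fin.consEquiv, Equiv.coe_fn_mk]
  congr 1
  refine Fin.lastCases ?_ (fun y => ?_) x
  · simp
  · rw [Fin.snoc_castSucc, Fin.coeSucc_eq_succ, Fin.cons_succ]

/-- twisted tensor power -/
def QQ {k ι X : Type} [Field k] [Fintype ι] [Fintype X] (A : Matrix ι ι k) (s : Equiv.Perm X) :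
    Matrix (X → ι) (X → ι) k := fun a c => ∏ x, A (a x) (c (s⁻¹ x))

theorem QQ_mul {k ι X : Type} [Field k] [Fintype ι] [Fintype X] (A B : Matrix ι ι k)
    (s t : Equiv.Perm X) : QQ A s * QQ B t = QQ (A * B) (s * t) := by
  ext a c
  rw [Matrix.mul_apply]
  simp only [QQ, Matrix.mul_apply]
  rw [Finset.prod_univ_sum, Fintype.piFinset_univ]
  rw [← (Equiv.arrowCongr s.symm (Equiv.refl ι)).sum_comp]
  refine Finset.sum_congr rfl fun b _ => ?_
  rw [Finset.prod_mul_distrib]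
  congr 1
  · refine Finset.prod_congr rfl fun x _ => ?_
    simp [Equiv.arrowCongr]
  · refine Eq.trans ?_ (Equiv.prod_comp s _)
    refine Finset.prod_congr rfl fun x _ => ?_
    simp [Equiv.arrowCongr]

theorem QQ_one {k ι X : Type} [Field k] [Fintype ι] [DecidableEq ι] [Fintype X]
    [DecidableEq (X → ι)] :
    QQ (1 : Matrix ι ι k) (1 : Equiv.Perm X) = 1 := by
  ext a c
  simp only [QQ, Matrix.one_apply, inv_one, Equiv.Perm.coe_one, id]
  by_cases h : a = c
  · simp [h]
  · rw [if_neg h]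
    obtain ⟨x, hx⟩ := Function.ne_iff.1 h
    exact Finset.prod_eq_zero (Finset.mem_univ x) (if_neg hx)

/-- the twisted tensor power as a representation -/
def QHom {k ι : Type} (X : Type) [Field k] {G : Type} [Group G] [Fintype ι] [DecidableEq ι]
    [Fintype X] (M : G →* Matrix ι ι k) :
    G × Equiv.Perm X →* Module.End k ((X → ι) → k) where
  toFun x := Matrix.toLin' (QQ (M x.1) x.2)
  map_one' := by
    rw [Prod.fst_one, Prod.snd_one, map_one, QQ_one]
    exact Matrix.toLin'_one
  map_mul' x y := by
    rw [Prod.fst_mul, Prod.snd_mul, map_mul, ← QQ_mul]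
    exact Matrix.toLin'_mul _ _

theorem QHom_trace {k ι X : Type} [Field k] {G : Type} [Group G] [Fintype ι] [DecidableEq ι]
    [Fintype X] (M : G →* Matrix ι ι k) (g : G) (s : Equiv.Perm X) :
    LinearMap.trace k _ (QHom X M (g, s)) = ∑ a : X → ι, ∏ x, M g (a x) (a (s⁻¹ x)) := by
  show LinearMap.trace k _ (Matrix.toLin' (QQ (M g) s)) = _
  rw [Matrix.trace_toLin'_eq]
  rfl

variable {k : Type} [Field k] [CharZero k] {G : Type} [Group G]

theorem inv_rep {S : Type} [Group S] [Fintype S] {E : Type} [AddCommGroup E] [Module k E]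
    [FiniteDimensional k E] (ρ : Representation k (G × S) E) :
    ∃ U : FDRep k G, ∀ g, U.character g =
      (Fintype.card S : k)⁻¹ * ∑ s : S, LinearMap.trace k E (ρ (g, s)) := by
  let R : Representation k G E := ρ.comp (MonoidHom.inl G S)
  let P : Representation k S E := ρ.comp (MonoidHom.inr G S)
  have hRP : ∀ g s, R g * P s = ρ (g, s) := fun g s => by
    simp [R, P, ← map_mul]
  have hPR : ∀ g s, P s * R g = ρ (g, s) := fun g s => by
    simp [R, P, ← map_mul]
  letI : Invertible (Fintype.card S : k) := invertibleOfNonzero (by simp)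
  have hinv : ∀ g : G, ∀ x ∈ P.invariants, R g x ∈ P.invariants := by
    intro g x hx s
    have h1 : P s (R g x) = R g (P s x) := by
      rw [← Module.End.mul_apply, ← Module.End.mul_apply, hPR, hRP]
    rw [h1, hx s]
  let U : Subrepresentation R := ⟨P.invariants, fun g x hx => hinv g x hx⟩
  refine ⟨FDRep.of U.toRepresentation, fun g => ?_⟩
  have hpr := Representation.isProj_averageMap P
  have h1 : (Fintype.card S : k)⁻¹ * ∑ s : S, LinearMap.trace k E (ρ (g, s)) =
      LinearMap.trace k E (R g * P.averageMap) := by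
    simp only [Representation.averageMap, GroupAlgebra.average, map_smul, map_sum,
      Representation.asAlgebraHom_of, mul_smul_comm, Finset.mul_sum, hRP, invOf_eq_inv, smul_eq_mul]
  rw [h1, ← LinearMap.trace_restrict_eq_of_forall_mem P.invariants (R g * P.averageMap)
    (fun x => hinv g _ (hpr.map_mem x))]
  show LinearMap.trace k _ ((R g).restrict (fun x hx => hinv g x hx)) = _
  congr 1
  ext x
  show R g x = R g (P.averageMap x)
  rw [hpr.map_id x x.2]


/-- affine permutations -/
def aff (q : ℕ) (u : (ZMod q)ˣ × ZMod q) : Equiv.Perm (ZMod q) where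
  toFun x := u.1 * x + u.2
  invFun x := (u.1⁻¹ : (ZMod q)ˣ) * (x - u.2)
  left_inv x := by simp
  right_inv x := by simp

theorem aff_apply (q : ℕ) (u : (ZMod q)ˣ) (t x : ZMod q) : aff q (u, t) x = u * x + t := rfl

theorem aff_mul (q : ℕ) (u v : (ZMod q)ˣ) (s t : ZMod q) :
    aff q (u, s) * aff q (v, t) = aff q (u * v, u * t + s) := by
  ext x
  simp [aff_apply, mul_add, mul_assoc, add_assoc]

theorem aff_one (q : ℕ) : aff q (1, 0) = 1 := by
  ext x
  simp [aff_apply]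

theorem aff_injective (q : ℕ) : Function.Injective (aff q) := by
  rintro ⟨u, s⟩ ⟨v, t⟩ h
  have h0 := DFunLike.congr_fun h 0
  have h1 := DFunLike.congr_fun h 1
  simp only [aff_apply, mul_zero, zero_add, mul_one] at h0 h1
  subst h0
  have : u = v := Units.ext (add_right_cancel h1)
  rw [this]

/-- the affine group -/
def affG (q : ℕ) : Subgroup (Equiv.Perm (ZMod q)) where
  carrier := Set.range (aff q)
  mul_mem' := by
    rintro _ _ ⟨⟨u, s⟩, rfl⟩ ⟨⟨v, t⟩, rfl⟩
    exact ⟨_, (aff_mul q u v s t).symm⟩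
  one_mem' := ⟨_, aff_one q⟩
  inv_mem' := by
    rintro _ ⟨⟨u, s⟩, rfl⟩
    refine ⟨(u⁻¹, -((u⁻¹ : (ZMod q)ˣ) * s)), ?_⟩
    rw [eq_inv_iff_mul_eq_one, aff_mul, ← aff_one]
    simp

def transHom (q : ℕ) : Multiplicative (ZMod q) →* Equiv.Perm (ZMod q) where
  toFun t := aff q (1, t.toAdd)
  map_one' := aff_one q
  map_mul' s t := by rw [aff_mul]; simp [add_comm]

def unitHom (q : ℕ) : (ZMod q)ˣ →* Equiv.Perm (ZMod q) where
  toFun u := aff q (u, 0)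
  map_one' := aff_one q
  map_mul' s t := by rw [aff_mul]; simp

theorem adams_prime (W : FDRep k G) {q : ℕ} (hq : q.Prime) :
    ∃ A B C : FDRep k G, ∀ g, W.character (g ^ q) =
      A.character g - B.character g + C.character g := by
  haveI : Fact q.Prime := ⟨hq⟩
  let b := Module.finBasis k W
  let M : G →* Matrix (Fin (Module.finrank k W)) (Fin (Module.finrank k W)) k :=
    { toFun := fun g => LinearMap.toMatrix b b (W.ρ g)
      map_one' := by rw [map_one]; exact LinearMap.toMatrix_one b
      map_mul' := fun x y => by rw [map_mul]; exact LinearMap.toMatrix_mul b _ _ }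
  have hM : ∀ g, W.character g = Matrix.trace (M g) := fun g =>
    LinearMap.trace_eq_matrix_trace k b (W.ρ g)
  let Q := QHom (ZMod q) M
  let τ : G → Equiv.Perm (ZMod q) → k := fun g s => LinearMap.trace k _ (Q (g, s))
  have hconj : ∀ g r s, τ g (r * s * r⁻¹) = τ g s := by
    intro g r s
    have : (g, r * s * r⁻¹) = ((1, r) * (g, s)) * (1, r)⁻¹ := by simp
    simp only [τ]
    rw [this, map_mul, LinearMap.trace_mul_comm, ← map_mul, inv_mul_cancel_left]
  have hz : ∀ g, τ g (aff q (1, -1)) = W.character (g ^ q) := by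
    intro g
    obtain ⟨N, hN⟩ : ∃ N, q = N + 1 := ⟨q - 1, by have := hq.pos; omega⟩
    subst hN
    have hinv : (aff (N + 1) (1, -1))⁻¹ = aff (N + 1) (1, 1) := by
      rw [inv_eq_iff_mul_eq_one, aff_mul, ← aff_one]; simp
    refine (QHom_trace M g _).trans ?_
    rw [hM, map_pow]
    refine Eq.trans ?_ (trace_cycle (M g) N).symm
    simp only [hinv, aff_apply, Units.val_one, one_mul]
    refine congrArg (fun I : Fintype (Fin (N + 1) → Fin (Module.finrank k W)) =>
      (@Finset.univ _ I).sum fun a => ∏ x : Fin (N + 1), M g (a x) (a (x + 1)))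
      (Subsingleton.elim _ _)
  have hcyc : ∀ g (t : ZMod q), t ≠ 0 → τ g (aff q (1, t)) = W.character (g ^ q) := by
    intro g t ht
    rw [← hz, ← hconj g (aff q (Units.mk0 (-t) (neg_ne_zero.2 ht), 0)) (aff q (1, -1))]
    congr 1
    rw [eq_mul_inv_iff_mul_eq, aff_mul, aff_mul]
    simp
  have hun : ∀ g (u : (ZMod q)ˣ) (t : ZMod q), u ≠ 1 → τ g (aff q (u, t)) = τ g (aff q (u, 0)) := by
    intro g u t hu
    have hu' : (1 - (u : ZMod q)) ≠ 0 := by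
      intro h; apply hu; ext; rw [Units.val_one]; exact (sub_eq_zero.1 h).symm
    rw [← hconj g (aff q (1, t / (1 - u))) (aff q (u, 0))]
    congr 1
    rw [eq_mul_inv_iff_mul_eq, aff_mul, aff_mul]
    congr 1
    ext
    · simp
    · simp; field_simp; ring
  obtain ⟨A, hA⟩ := inv_rep (Q.comp (MonoidHom.prodMap (MonoidHom.id G) (transHom q)))
  obtain ⟨B, hB⟩ := inv_rep (Q.comp (MonoidHom.prodMap (MonoidHom.id G) (unitHom q)))
  obtain ⟨C, hC⟩ := inv_rep (Q.comp (MonoidHom.prodMap (MonoidHom.id G) (affG q).subtype))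
  refine ⟨A, B, C, fun g => ?_⟩
  have hqk : (q : k) ≠ 0 := by exact_mod_cast hq.ne_zero
  have hq1 : (q : k) - 1 ≠ 0 := by
    rw [sub_ne_zero]; exact_mod_cast hq.one_lt.ne'
  have eA : A.character g = (q : k)⁻¹ * ∑ t : ZMod q, τ g (aff q (1, t)) := by
    rw [hA, Fintype.card_multiplicative, ZMod.card]
    congr 1
    exact Fintype.sum_equiv Multiplicative.toAdd _ _ (fun _ => rfl)
  have hcu : (Fintype.card (ZMod q)ˣ : k) = q - 1 := by
    rw [ZMod.card_units_eq_totient, Nat.totient_prime hq, Nat.cast_sub hq.one_lt.le, Nat.cast_one]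
  have eB : B.character g = ((q : k) - 1)⁻¹ * ∑ u : (ZMod q)ˣ, τ g (aff q (u, 0)) := by
    rw [hB, hcu]
    rfl
  have eC : C.character g = (((q : k) - 1) * q)⁻¹ *
      ∑ u : (ZMod q)ˣ, ∑ t : ZMod q, τ g (aff q (u, t)) := by
    rw [hC, ← Fintype.sum_prod_type' (fun u t => τ g (aff q (u, t)))]
    let e : (ZMod q)ˣ × ZMod q ≃ affG q := Equiv.ofInjective (aff q) (aff_injective q)
    congr 1
    · rw [← Fintype.card_congr e, Fintype.card_prod, Nat.cast_mul, hcu, ZMod.card]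
    · rw [← e.sum_comp]
      rfl
  have s1 : ∑ t : ZMod q, τ g (aff q (1, t)) =
      τ g (aff q (1, 0)) + ((q : k) - 1) * W.character (g ^ q) := by
    rw [← Finset.add_sum_erase _ _ (Finset.mem_univ (0 : ZMod q)),
      Finset.sum_congr rfl (fun t ht => hcyc g t (Finset.ne_of_mem_erase ht)), Finset.sum_const,
      Finset.card_erase_of_mem (Finset.mem_univ _), Finset.card_univ, ZMod.card, nsmul_eq_mul,
      Nat.cast_sub hq.one_lt.le, Nat.cast_one]
  rw [eA, eB, eC, ← Finset.add_sum_erase _ (fun u => ∑ t : ZMod q, τ g (aff q (u, t)))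
      (Finset.mem_univ (1 : (ZMod q)ˣ)), ← Finset.add_sum_erase _ (fun u => τ g (aff q (u, 0)))
      (Finset.mem_univ (1 : (ZMod q)ˣ))]
  have s2 : ∑ u ∈ Finset.univ.erase (1 : (ZMod q)ˣ), ∑ t : ZMod q, τ g (aff q (u, t)) =
      q * ∑ u ∈ Finset.univ.erase (1 : (ZMod q)ˣ), τ g (aff q (u, 0)) := by
    rw [Finset.mul_sum]
    refine Finset.sum_congr rfl fun u hu => ?_
    rw [Finset.sum_congr rfl (fun t _ => hun g u t (Finset.ne_of_mem_erase hu)), Finset.sum_const,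
      Finset.card_univ, ZMod.card, nsmul_eq_mul]
  rw [s2, s1]
  field_simp
  ring

end Adams
end Genotype
namespace Genotype
set_option linter.style.haveILetI false
set_option linter.unusedSectionVars false
section Fin4

variable {k : Type} [Field k] [CharZero k] {G : Type} [Group G] [Fintype G]

theorem pos_def {X : G → k} (hX : IsVirt X) {N : ℤ} (h : ip X X = N) :
    0 ≤ N ∧ (N = 0 → X = 0) := by
  obtain ⟨A, B, rfl⟩ := hX
  set n := Nat.card G with hn'
  have hn : 0 < n := Nat.card_pos
  have hG : ∀ g : G, g ^ n = 1 := fun g => pow_card_eq_one'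
  obtain ⟨ζ, hζ⟩ := exists_zeta k hn
  let τ : MM k →+* ℂ := (IsAlgClosed.lift : MM k →ₐ[ℚ] ℂ).toRingHom
  let E : FDRep k G → G → MM k := fun V g => emb hn hG V ⟨V.character g, mem_charField _ _⟩
  have hE : ∀ V g, algebraMap (MM k) (AlgebraicClosure k) (E V g) =
    algebraMap k (AlgebraicClosure k) (V.character g) := fun V g => rfl
  have hinv : ∀ g : G, g ^ (n - 1) = g⁻¹ := fun g => by
    rw [eq_inv_iff_mul_eq_one, ← pow_succ, Nat.sub_add_cancel hn, hG]
  have hz : (starRingEnd ℂ) (τ ζ) = (τ ζ) ^ (n - 1) := by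
    have h1 : (τ ζ) ^ n = 1 := by rw [← map_pow, hζ.pow_eq_one, map_one]
    rw [← Complex.inv_eq_conj (Complex.norm_eq_one_of_pow_eq_one h1 hn.ne')]
    symm
    apply eq_inv_of_mul_eq_one_left
    rw [← pow_succ, Nat.sub_add_cancel hn, h1]
  have hF : ∀ V g, (starRingEnd ℂ) (τ (E V g)) = τ (E V g⁻¹) := by
    intro V g
    have := hom_char hn hG hζ ((starRingEnd ℂ).comp τ) τ hz V g
    rw [hinv] at this
    exact this
  have hsum : (n : MM k) * N = ∑ g : G, (E A g - E B g) * (E A g⁻¹ - E B g⁻¹) := by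
    apply (algebraMap (MM k) (AlgebraicClosure k)).injective
    simp only [map_sum, map_mul, map_sub, hE, map_natCast, map_intCast]
    have h2 : (n : k) * N = ∑ g : G, (A.character g - B.character g) *
        (A.character g⁻¹ - B.character g⁻¹) := by
      rw [← h, ip, mul_inv_cancel_left₀ (by exact_mod_cast hn.ne')]
      rfl
    have h3 := congrArg (algebraMap k (AlgebraicClosure k)) h2
    simpa only [map_sum, map_mul, map_sub, map_natCast, map_intCast] using h3
  have hC : ((n : ℝ) * N : ℝ) = ∑ g : G, Complex.normSq (τ (E A g) - τ (E B g)) := by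
    have h3 := congrArg τ hsum
    simp only [map_sum, map_mul, map_sub, map_natCast, map_intCast, ← hF] at h3
    simp only [← map_sub, Complex.mul_conj] at h3
    simp only [map_sub] at h3
    exact_mod_cast h3
  have hnR : (0 : ℝ) < n := by exact_mod_cast hn
  have h0 : 0 ≤ ∑ g : G, Complex.normSq (τ (E A g) - τ (E B g)) :=
    Finset.sum_nonneg fun g _ => Complex.normSq_nonneg _
  constructor
  · rw [← hC] at h0
    exact_mod_cast nonneg_of_mul_nonneg_right h0 hnR
  · intro hN
    rw [hN, Int.cast_zero, mul_zero] at hC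
    have h4 := (Finset.sum_eq_zero_iff_of_nonneg (fun g _ => Complex.normSq_nonneg _)).1 hC.symm
    ext g
    have h5 := τ.injective (sub_eq_zero.1 (Complex.normSq_eq_zero.1 (h4 g (Finset.mem_univ g))))
    have h6 := congrArg (algebraMap (MM k) (AlgebraicClosure k)) h5
    rw [hE, hE] at h6
    have h7 := (algebraMap k (AlgebraicClosure k)).injective h6
    simp [h7]

theorem IsVirt.neg {f : G → k} (hf : IsVirt f) : IsVirt (-f) := by
  obtain ⟨A, B, rfl⟩ := hf
  exact ⟨B, A, by simp⟩

theorem IsVirt.add {f f' : G → k} (hf : IsVirt f) (hf' : IsVirt f') : IsVirt (f + f') := by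
  obtain ⟨A, B, rfl⟩ := hf
  obtain ⟨A', B', rfl⟩ := hf'
  obtain ⟨U, hU⟩ := exists_add A A'
  obtain ⟨U', hU'⟩ := exists_add B B'
  exact ⟨U, U', by rw [hU, hU']; ring⟩

theorem isVirt_char (A : FDRep k G) : IsVirt A.character := by
  obtain ⟨Z, hZ⟩ := exists_zero (k := k) (G := G)
  exact ⟨A, Z, by simp [hZ]⟩

theorem isVirt_zero : IsVirt (0 : G → k) := by
  obtain ⟨Z, hZ⟩ := exists_zero (k := k) (G := G)
  exact ⟨Z, Z, by simp⟩

theorem IsVirt.nsmul {f : G → k} (hf : IsVirt f) (c : ℕ) : IsVirt ((c : k) • f) := by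
  induction c with
  | zero => simpa using isVirt_zero
  | succ c ih =>
    rw [Nat.cast_succ, add_smul, one_smul]
    exact ih.add hf

theorem IsVirt.zsmul {f : G → k} (hf : IsVirt f) (c : ℤ) : IsVirt ((c : k) • f) := by
  obtain ⟨m, rfl | rfl⟩ := c.eq_nat_or_neg
  · simpa using hf.nsmul m
  · simpa using (hf.nsmul m).neg

theorem pow_congr {a b : ℕ} (h : a ≡ b [MOD Nat.card G]) (g : G) : g ^ a = g ^ b :=
  pow_eq_pow_iff_modEq.2 (h.of_dvd (orderOf_dvd_natCard g))

theorem exists_inv {a : ℕ} (ha : a.Coprime (Nat.card G)) :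
    ∃ b : ℕ, b.Coprime (Nat.card G) ∧ ∀ g : G, (g ^ a) ^ b = g := by
  haveI : NeZero (Nat.card G) := ⟨Nat.card_pos.ne'⟩
  let u := ZMod.unitOfCoprime a ha
  refine ⟨((u⁻¹ : (ZMod (Nat.card G))ˣ) : ZMod (Nat.card G)).val, ZMod.val_coe_unit_coprime _, ?_⟩
  intro g
  rw [← pow_mul]
  conv_rhs => rw [← pow_one g]
  apply pow_congr
  rw [← ZMod.natCast_eq_natCast_iff]
  push_cast
  rw [ZMod.natCast_val, ZMod.cast_id, ← ZMod.coe_unitOfCoprime a ha]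
  exact u.mul_inv

theorem ip_pow {a : ℕ} (ha : a.Coprime (Nat.card G)) (f h : G → k) :
    ip (fun g => f (g ^ a)) (fun g => h (g ^ a)) = ip f h := by
  obtain ⟨b, hb, hab⟩ := exists_inv (G := G) ha
  unfold ip
  congr 1
  exact Fintype.sum_equiv ⟨fun g => g ^ a, fun g => g ^ b, hab, fun g => by
    show (g ^ b) ^ a = g
    rw [pow_right_comm, hab]⟩ _ _ (fun g => by simp [inv_pow])

theorem isVirt_pow (W : FDRep k G) {a : ℕ} (ha : a.Coprime (Nat.card G)) :
    IsVirt (fun g => W.character (g ^ a)) := by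
  haveI : NeZero (Nat.card G) := ⟨Nat.card_pos.ne'⟩
  obtain ⟨q, -, hq, hqa⟩ := Nat.forall_exists_prime_gt_and_eq_mod
    (ZMod.unitOfCoprime a ha).isUnit 0
  rw [ZMod.coe_unitOfCoprime, ZMod.natCast_eq_natCast_iff] at hqa
  obtain ⟨A, B, C, h⟩ := adams_prime W hq
  obtain ⟨U, hU⟩ := exists_add A C
  refine ⟨U, B, ?_⟩
  ext g
  rw [← pow_congr hqa g, h, hU]
  simp only [Pi.sub_apply, Pi.add_apply]
  ring

theorem irr_pow {V : FDRep k G} (hV : IsIrr V) {a : ℕ} (ha : a.Coprime (Nat.card G)) :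
    ∃ T : FDRep k G, IsIrr T ∧ ∀ g, T.character g = V.character (g ^ a) := by
  obtain ⟨b, hb, hab⟩ := exists_inv (G := G) ha
  set F : G → k := fun g => V.character (g ^ a) with hF
  have hFv : IsVirt F := isVirt_pow V ha
  obtain ⟨s, hs, hs'⟩ := ip_self_pos hV
  have hFF : ip F F = s := by rw [← hs']; exact ip_pow ha _ _
  obtain ⟨T, hT, hTF⟩ := exists_irr_of_virt hFv (by rw [hFF]; exact_mod_cast hs.ne')
  obtain ⟨t, ht, ht'⟩ := ip_self_pos hT
  obtain ⟨c, hc⟩ := virt_ip hFv hT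
  obtain ⟨d, hd⟩ := virt_ip (isVirt_pow T hb) hV
  have h1 : ip (fun g => T.character (g ^ b)) V.character = ip F T.character := by
    rw [← ip_pow ha, ip_comm]
    simp only [hab]
    rfl
  rw [h1, hs'] at hd
  rw [ht'] at hc
  have hctds : c * t = d * s := by
    have := hc.symm.trans hd
    exact_mod_cast this
  have hct : c * t ≠ 0 := by
    intro h0
    apply hTF
    rw [hc]
    exact_mod_cast h0
  have hXv : IsVirt (F - (c : k) • T.character) := by
    rw [sub_eq_add_neg]
    exact hFv.add ((isVirt_char T).zsmul c).neg
  have hXX : ip (F - (c : k) • T.character) (F - (c : k) • T.character) = (s - c * (c * t) : ℤ) := by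
    rw [ip_sub_left, ip_smul_left, ip_comm F, ip_comm T.character, ip_sub_left, ip_sub_left,
      ip_smul_left, ip_smul_left, hFF, ip_comm T.character F, hc, ht']
    push_cast
    ring
  obtain ⟨hp, hp'⟩ := pos_def hXv hXX
  have hs0 : (0 : ℤ) < s := by exact_mod_cast hs
  have ht0 : (0 : ℤ) < t := by exact_mod_cast ht
  have hc0 : c ≠ 0 := by rintro rfl; simp at hct
  have hcd : 0 < c * d := by
    have : 0 < (c * d) * s := by
      have : (c * d) * s = c ^ 2 * t := by rw [mul_assoc, ← hctds]; ring
      rw [this]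
      positivity
    exact (mul_pos_iff_of_pos_right hs0).1 this
  have hcd1 : c * d = 1 := by
    rw [hctds] at hp
    have : 0 ≤ s * (1 - c * d) := by linarith
    have := nonneg_of_mul_nonneg_right this hs0
    omega
  have hX0 := hp' (by rw [hctds, ← mul_assoc, hcd1]; ring)
  have hFT : ∀ g, F g = c * T.character g := by
    intro g
    have := congrFun hX0 g
    simpa [sub_eq_zero] using this
  have hc1 : c = 1 := by
    rcases Int.eq_one_or_neg_one_of_mul_eq_one hcd1 with h | h
    · exact h
    · exfalso
      have e1 := hFT 1
      simp only [hF, one_pow, FDRep.char_one, h] at e1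
      have hpos : 0 < Module.finrank k V := by
        have := hV.1
        exact Module.finrank_pos
      have e2 : ((Module.finrank k V + Module.finrank k T : ℕ) : k) = 0 := by
        push_cast at e1 ⊢
        rw [e1]; ring
      have e3 := Nat.cast_eq_zero.1 e2
      omega
  exact ⟨T, hT, fun g => by have := hFT g; rw [hc1] at this; rw [Int.cast_one, one_mul] at this; exact this.symm⟩

/-- extension by zero -/
def extz (H : Subgroup G) (f : H → k) (g : G) : k := if h : g ∈ H then f ⟨g, h⟩ else 0

theorem indChar_eq (H : Subgroup G) (f : H → k) (g : G) :
    indChar H f g = (Nat.card H : k)⁻¹ * ∑ x : G, extz H f (x⁻¹ * g * x) := by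
  unfold indChar
  rw [finsum_eq_sum_of_fintype]
  rfl

theorem frob (H : Subgroup G) (ψ : FDRep k G) (f : H → k) :
    ip ψ.character (indChar H f) = ip (resChar H ψ.character) f := by
  have h1 : ∀ x : G, ∑ g : G, ψ.character g * extz H f (x⁻¹ * g⁻¹ * x) =
      ∑ h : H, ψ.character h * f h⁻¹ := by
    intro x
    have h2 : ∑ g : G, ψ.character g * extz H f (x⁻¹ * g⁻¹ * x) =
        ∑ u : G, ψ.character u * extz H f u⁻¹ := by
      refine (Fintype.sum_equiv (MulAut.conj x).toEquiv _ _ (fun u => ?_)).symm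
      simp only [MulEquiv.toEquiv_eq_coe, EquivLike.coe_coe, MulAut.conj_apply, FDRep.char_conj]
      congr 2
      group
    rw [h2]
    symm
    refine Finset.sum_of_injOn (fun h : H => (h : G)) (Subtype.val_injective.injOn)
      (fun _ _ => Finset.mem_coe.2 (Finset.mem_univ _)) ?_ ?_
    · intro u _ hu
      have : u⁻¹ ∉ H := by
        intro h
        exact hu ⟨⟨u, by simpa using h⟩, by simp, rfl⟩
      simp [extz, this]
    · intro h _
      have : ((h : G))⁻¹ ∈ H := H.inv_mem h.2
      rw [extz, dif_pos this]
      rfl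
  unfold ip
  simp only [indChar_eq]
  have h3 : ∑ g : G, ψ.character g *
      ((Nat.card H : k)⁻¹ * ∑ x : G, extz H f (x⁻¹ * g⁻¹ * x)) =
      (Nat.card H : k)⁻¹ * ∑ x : G, ∑ g : G, ψ.character g * extz H f (x⁻¹ * g⁻¹ * x) := by
    rw [Finset.sum_comm, Finset.mul_sum]
    refine Finset.sum_congr rfl fun g _ => ?_
    rw [Finset.mul_sum, Finset.mul_sum, Finset.mul_sum]
    exact Finset.sum_congr rfl fun x _ => by ring
  rw [h3]
  simp only [h1, Finset.sum_const, Finset.card_univ, nsmul_eq_mul, Nat.card_eq_fintype_card]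
  have : (Fintype.card G : k) ≠ 0 := by simp
  rw [mul_left_comm, inv_mul_cancel_left₀ this]
  rfl

theorem ind_pow (H : Subgroup G) (f : H → k) {a : ℕ} (ha : a.Coprime (Nat.card G)) (g : G) :
    indChar H (fun h => f (h ^ a)) g = indChar H f (g ^ a) := by
  obtain ⟨b, hb, hab⟩ := exists_inv (G := G) ha
  rw [indChar_eq, indChar_eq]
  congr 1
  refine Finset.sum_congr rfl fun x _ => ?_
  have h1 : x⁻¹ * g ^ a * x = (x⁻¹ * g * x) ^ a := by
    have := conj_pow (i := a) (a := x⁻¹) (b := g)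
    rw [inv_inv] at this
    exact this.symm
  rw [h1]
  set u := x⁻¹ * g * x
  by_cases hu : u ∈ H
  · rw [extz, extz, dif_pos hu, dif_pos (H.pow_mem hu a)]
    rfl
  · have hu' : u ^ a ∉ H := fun h => hu (by rw [← hab u]; exact H.pow_mem h b)
    rw [extz, extz, dif_neg hu, dif_neg hu']

theorem charField_ind (H : Subgroup G) (f : H → k) : charField (indChar H f) ≤ charField f := by
  refine Subfield.closure_le.2 ?_
  rintro _ ⟨g, rfl⟩
  rw [indChar_eq]
  refine mul_mem (inv_mem (natCast_mem _ _)) (sum_mem fun x _ => ?_)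
  unfold extz
  split_ifs
  · exact mem_charField _ _
  · exact zero_mem _

end Fin4
end Genotype
namespace Genotype

/-- **The Narrow Lemma.** Let `H ≤ G` and let the `𝕂G`-irrep `ψ` be induced from the
`𝕂H`-irrep `φ`. The following are equivalent: (a) no Galois conjugate of `φ` distinct
from `φ` occurs in `res_H^G ψ`; (b) induction gives a bijective correspondence between
the (isomorphism classes of, i.e. characters of) Galois conjugates of `ψ` and the Galois
conjugates of `φ`; (c) `ℚ[φ] = ℚ[ψ]`. -/
theorem narrow_lemma (p : ℕ) (hp : p.Prime)
    (G : Type) [Group G] [Fintype G] (hG : IsPGroup p G)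
    (k : Type) [Field k] [CharZero k] (H : Subgroup G)
    (ψ : FDRep k G) (hψ : IsIrr ψ) (φ : FDRep k H) (hφ : IsIrr φ)
    (hind : ψ.character = indChar H φ.character) :
    ((∀ φ' : FDRep k H, IsIrr φ' → IsGaloisConj φ.character φ'.character →
        CharOccurs φ'.character (resChar H ψ.character) → φ'.character = φ.character) ↔
      ((∀ ψ' : FDRep k G, IsIrr ψ' → IsGaloisConj ψ.character ψ'.character →
          ∃! cφ' : H → k,
            (∃ φ' : FDRep k H, IsIrr φ' ∧ IsGaloisConj φ.character φ'.character ∧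
              cφ' = φ'.character) ∧ ψ'.character = indChar H cφ') ∧
        (∀ φ' : FDRep k H, IsIrr φ' → IsGaloisConj φ.character φ'.character →
          ∃! cψ' : G → k,
            (∃ ψ' : FDRep k G, IsIrr ψ' ∧ IsGaloisConj ψ.character ψ'.character ∧
              cψ' = ψ'.character) ∧ cψ' = indChar H φ'.character))) ∧
    ((∀ φ' : FDRep k H, IsIrr φ' → IsGaloisConj φ.character φ'.character →
        CharOccurs φ'.character (resChar H ψ.character) → φ'.character = φ.character) ↔
      charField φ.character = charField ψ.character) := by
  set n := Nat.card G with hn'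
  have hn : 0 < n := Nat.card_pos
  have hGn : ∀ g : G, g ^ n = 1 := fun g => pow_card_eq_one'
  have hHn : ∀ g : H, g ^ n = 1 := fun g => Subtype.ext (by simpa using hGn g)
  have hcop : ∀ a : ℕ, a.Coprime n → a.Coprime (Nat.card H) := fun a ha =>
    ha.coprime_dvd_right (Subgroup.card_subgroup_dvd_card H)
  have hres : resChar H ψ.character =
      (FDRep.of (ψ.ρ.comp H.subtype) : FDRep k H).character := rfl
  have hindpow : ∀ (a : ℕ), a.Coprime n → ∀ φ' : FDRep k H,
      (∀ g, φ'.character g = φ.character (g ^ a)) →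
      ∀ g, indChar H φ'.character g = ψ.character (g ^ a) := by
    intro a ha φ' h g
    have : φ'.character = fun h => φ.character (h ^ a) := funext h
    rw [this, ind_pow H _ ha, hind]
  have hle : charField ψ.character ≤ charField φ.character := by
    rw [hind]; exact charField_ind H _
  have hψψ : ip ψ.character ψ.character ≠ 0 := by
    obtain ⟨d, hd, hd'⟩ := ip_self_pos hψ
    rw [hd']; exact_mod_cast hd.ne'
  have hac : (∀ φ' : FDRep k H, IsIrr φ' → IsGaloisConj φ.character φ'.character →
        CharOccurs φ'.character (resChar H ψ.character) → φ'.character = φ.character) →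
      charField φ.character = charField ψ.character := by
    intro hA
    refine le_antisymm (field_le_of_pow hn hGn hHn ψ φ fun a ha h => ?_) hle
    obtain ⟨T, hT, hTa⟩ := irr_pow hφ (hcop a ha)
    have h1 := hA T hT (galConj_of_pow hn hHn φ T ha hTa) (by
      rw [hres, occurs_iff hT, ← hres, ← frob]
      have : indChar H T.character = ψ.character := by
        ext g; rw [hindpow a ha T hTa, h]
      rw [this]; exact hψψ)
    intro g
    rw [← hTa, h1]
  have hca : charField φ.character = charField ψ.character →
      (∀ φ' : FDRep k H, IsIrr φ' → IsGaloisConj φ.character φ'.character →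
        CharOccurs φ'.character (resChar H ψ.character) → φ'.character = φ.character) := by
    intro hC φ' hφ' hconj hocc
    obtain ⟨a, ha, hφa⟩ := galConj_pow hn hHn φ φ' hconj
    rw [hres, occurs_iff hφ', ← hres, ← frob] at hocc
    obtain ⟨T, hT, hTa⟩ := irr_pow hψ ha
    have h1 : indChar H φ'.character = T.character := by
      ext g; rw [hindpow a ha φ' hφa, hTa]
    rw [h1] at hocc
    have h2 := schur hT hψ hocc
    ext g
    have h3 := pow_eq_of_field hn hGn hHn ψ φ hC.le ha (Nat.coprime_one_left n)
      (fun g => by rw [← hTa, ← h2, pow_one]) g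
    rw [hφa, h3, pow_one]
  refine ⟨⟨fun hA => ?_, fun hB => ?_⟩, hac, hca⟩
  · have hC := hac hA
    constructor
    · intro ψ' _ hconj
      obtain ⟨a, ha, hψa⟩ := galConj_pow hn hGn ψ ψ' hconj
      obtain ⟨T, hT, hTa⟩ := irr_pow hφ (hcop a ha)
      refine ⟨T.character, ⟨⟨T, hT, galConj_of_pow hn hHn φ T ha hTa, rfl⟩, ?_⟩, ?_⟩
      · ext g; rw [hψa, hindpow a ha T hTa]
      · rintro _ ⟨⟨φ', _, hconj', rfl⟩, hi⟩
        obtain ⟨b, hb, hφb⟩ := galConj_pow hn hHn φ φ' hconj'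
        ext g
        rw [hTa, hφb]
        refine pow_eq_of_field hn hGn hHn ψ φ hC.le hb ha (fun g => ?_) g
        rw [← hψa, hi, hindpow b hb φ' hφb]
    · intro φ' _ hconj
      obtain ⟨a, ha, hφa⟩ := galConj_pow hn hHn φ φ' hconj
      obtain ⟨T, hT, hTa⟩ := irr_pow hψ ha
      refine ⟨T.character, ⟨⟨T, hT, galConj_of_pow hn hGn ψ T ha hTa, rfl⟩, ?_⟩, ?_⟩
      · ext g; rw [hTa, hindpow a ha φ' hφa]
      · rintro _ ⟨-, hi⟩
        ext g; rw [hi, hTa, hindpow a ha φ' hφa]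
  · refine hca (le_antisymm (field_le_of_pow hn hGn hHn ψ φ fun a ha h => ?_) hle)
    obtain ⟨T, hT, hTa⟩ := irr_pow hφ (hcop a ha)
    have hψ1 := galConj_of_pow hn hGn ψ ψ (Nat.coprime_one_left n) (fun g => by rw [pow_one])
    have hφ1 := galConj_of_pow hn hHn φ φ (Nat.coprime_one_left n) (fun g => by rw [pow_one])
    have h1 := (hB.1 ψ hψ hψ1).unique
      ⟨⟨T, hT, galConj_of_pow hn hHn φ T ha hTa, rfl⟩, by
        ext g; rw [hindpow a ha T hTa, h]⟩
      ⟨⟨φ, hφ, hφ1, rfl⟩, hind⟩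
    intro g
    rw [← hTa, h1]

end Genotype
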